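/- arXiv:0907.0690 — 2 statements merged into one kernel-verified Lean document; each statement's English description precedes it below -/
import Mathlib

section
/- Let γ(x) = gx + u be an affine isometry of Minkowski space ℝ³ whose linear part g is hyperbolic or parabolic, and let v be a nonzero vector with gv = v. Then α_v(γ) = 0 if and only if γ fixes a point of ℝ³. -/
open Matrix

noncomputable section

/-- Minkowski space: ℝ³. -/
abbrev V3 : Type := Fin 3 → ℝ

/-- The Lorentzian inner product `x·y = x₁y₁ + x₂y₂ − x₃y₃`. -/
def mdot (x y : V3) : ℝ := x 0 * y 0 + x 1 * y 1 - x 2 * y 2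

/-- The Lorentzian cross product: the unique bilinear map with
`mdot u (lcross v w) = det [u v w]` (columns `u`, `v`, `w`). -/
def lcross (v w : V3) : V3 :=
  ![v 1 * w 2 - v 2 * w 1, v 2 * w 0 - v 0 * w 2, -(v 0 * w 1 - v 1 * w 0)]

/-- For a spacelike vector `v`, the future-pointing null vector `v⁺` of Euclidean
length 1 which is Lorentz-orthogonal to `v`, where `v⁻, v⁺` are ordered so that
`det[v⁻ v⁺ v] > 0`. -/
def nullPlus (v : V3) : V3 :=
  (1 / (Real.sqrt 2 * (v 0 ^ 2 + v 1 ^ 2))) •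
    ![v 0 * v 2 + v 1 * Real.sqrt (mdot v v),
      v 1 * v 2 - v 0 * Real.sqrt (mdot v v),
      v 0 ^ 2 + v 1 ^ 2]

/-- For a spacelike vector `v`, the future-pointing null vector `v⁻` of Euclidean
length 1 which is Lorentz-orthogonal to `v`, where `v⁻, v⁺` are ordered so that
`det[v⁻ v⁺ v] > 0`. -/
def nullMinus (v : V3) : V3 :=
  (1 / (Real.sqrt 2 * (v 0 ^ 2 + v 1 ^ 2))) •
    ![v 0 * v 2 - v 1 * Real.sqrt (mdot v v),
      v 1 * v 2 + v 0 * Real.sqrt (mdot v v),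
      v 0 ^ 2 + v 1 ^ 2]

/-- `P(x)`: for a future-pointing null vector `x`, the set of spacelike vectors `w`
with `w·x = 0` such that `(w/√(w·w))⁺` is a positive scalar multiple of `x`. -/
def wingSet (x : V3) : Set V3 :=
  {w | 0 < mdot w w ∧ mdot w x = 0 ∧
    ∃ t : ℝ, 0 < t ∧ nullPlus ((Real.sqrt (mdot w w))⁻¹ • w) = t • x}

/-- The crooked plane `C(v,p)`: union of the stem `p + {x | x·v = 0, x·x ≤ 0}`
and the wings `p + P(v⁺)` and `p + P(v⁻)`. -/
def crookedPlane (v p : V3) : Set V3 :=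
  {q | mdot (q - p) v = 0 ∧ mdot (q - p) (q - p) ≤ 0} ∪
  {q | q - p ∈ wingSet (nullPlus v)} ∪
  {q | q - p ∈ wingSet (nullMinus v)}

/-- The crooked half-space `H(v,p)`. -/
def crookedHalf (v p : V3) : Set V3 :=
  {q | (0 ≤ mdot (q - p) v → mdot (q - p) (nullPlus v) ≤ 0) ∧
       (mdot (q - p) v ≤ 0 → 0 ≤ mdot (q - p) (nullMinus v))}

/-- Spacelike vectors `u`, `v` are consistently oriented. -/
def consistentlyOriented (u v : V3) : Prop :=
  mdot u v < 0 ∧ mdot u (nullPlus v) ≤ 0 ∧ mdot u (nullMinus v) ≤ 0 ∧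
  mdot v (nullPlus u) ≤ 0 ∧ mdot v (nullMinus u) ≤ 0

/-- `g` is a linear isometry of the Lorentzian inner product. -/
def isLorentz (g : Matrix (Fin 3) (Fin 3) ℝ) : Prop :=
  ∀ x y : V3, mdot (g.mulVec x) (g.mulVec y) = mdot x y

/-- Membership in `SO(2,1)⁰`, the identity component of the group of linear
isometries of `mdot`: Lorentzian, determinant one, and orthochronous. -/
def inSO21p (g : Matrix (Fin 3) (Fin 3) ℝ) : Prop :=
  isLorentz g ∧ g.det = 1 ∧ 0 < g.mulVec ![0, 0, 1] 2

/-- `g` is hyperbolic: it has three distinct real eigenvalues. -/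
def isHyperbolic (g : Matrix (Fin 3) (Fin 3) ℝ) : Prop :=
  ∃ a b c : ℝ, a ≠ b ∧ a ≠ c ∧ b ≠ c ∧
    g.charpoly = (Polynomial.X - Polynomial.C a) * (Polynomial.X - Polynomial.C b) *
      (Polynomial.X - Polynomial.C c)

/-- `g ≠ I` is parabolic: `1` is its only eigenvalue. -/
def isParabolic (g : Matrix (Fin 3) (Fin 3) ℝ) : Prop :=
  g ≠ 1 ∧ g.charpoly = (Polynomial.X - Polynomial.C 1) ^ 3

/-- `v` is a positive fixed vector of `g`: `gv = v`, `v ≠ 0`, and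
`det[v x gx] > 0` for some null or timelike `x` which is not an eigenvector. -/
def positiveFixed (g : Matrix (Fin 3) (Fin 3) ℝ) (v : V3) : Prop :=
  v ≠ 0 ∧ g.mulVec v = v ∧
  ∃ x : V3, mdot x x ≤ 0 ∧ (∀ t : ℝ, g.mulVec x ≠ t • x) ∧
    0 < mdot v (lcross x (g.mulVec x))

/-- A subgroup of homeomorphisms (here: permutations) of ℝ³ acts properly
discontinuously: for every compact `K`, only finitely many elements move `K`
to meet `K`. -/
def properlyDisc (Γ : Subgroup (Equiv.Perm V3)) : Prop :=
  ∀ K : Set V3, IsCompact K →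
    {f : Equiv.Perm V3 | f ∈ Γ ∧ ((f : V3 → V3) '' K ∩ K).Nonempty}.Finite

/-- The action of `Γ` on ℝ³ is free: no nonidentity element has a fixed point. -/
def freeAction (Γ : Subgroup (Equiv.Perm V3)) : Prop :=
  ∀ f ∈ Γ, f ≠ 1 → ∀ x : V3, f x ≠ x

lemma mdot_add_left (x y z : V3) : mdot (x + y) z = mdot x z + mdot y z := by
  simp only [mdot, Pi.add_apply]; ring

lemma mdot_sub_left (x y z : V3) : mdot (x - y) z = mdot x z - mdot y z := by
  simp only [mdot, Pi.sub_apply]; ring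

lemma mdot_smul_left (t : ℝ) (x y : V3) : mdot (t • x) y = t * mdot x y := by
  simp only [mdot, Pi.smul_apply, smul_eq_mul]; ring

lemma mdot_comm (x y : V3) : mdot x y = mdot y x := by
  simp only [mdot]; ring

lemma exists_mdot_ne_zero {x : V3} (hx : x ≠ 0) : ∃ y, mdot y x ≠ 0 := by
  refine ⟨![x 0, x 1, -x 2], fun h => hx ?_⟩
  simp only [mdot, cons_val] at h
  have h0 : x 0 = 0 := by nlinarith [sq_nonneg (x 0), sq_nonneg (x 1), sq_nonneg (x 2)]
  have h1 : x 1 = 0 := by nlinarith [sq_nonneg (x 0), sq_nonneg (x 1), sq_nonneg (x 2)]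
  have h2 : x 2 = 0 := by nlinarith [sq_nonneg (x 0), sq_nonneg (x 1), sq_nonneg (x 2)]
  ext i
  fin_cases i <;> assumption

lemma exists_smul_eq_of_lcross_eq_zero {v w : V3} (hv : v ≠ 0) (h : lcross v w = 0) :
    ∃ t : ℝ, t • v = w := by
  have e0 := congrFun h 0
  have e1 := congrFun h 1
  have e2 := congrFun h 2
  simp only [lcross, cons_val, Pi.zero_apply] at e0 e1 e2
  obtain ⟨i, hi⟩ := Function.ne_iff.mp hv
  rw [Pi.zero_apply] at hi
  refine ⟨w i / v i, ?_⟩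
  ext j
  simp only [Pi.smul_apply, smul_eq_mul]
  rw [div_mul_eq_mul_div, div_eq_iff hi]
  fin_cases i <;> fin_cases j <;> simp only [Fin.zero_eta, Fin.mk_one, Fin.reduceFinMk] <;>
    linarith

lemma lcross_lcross_eq_zero {v a w : V3} (hv : mdot w v = 0) (ha : mdot w a = 0) :
    lcross (lcross v a) w = 0 := by
  simp only [mdot] at hv ha
  ext i
  fin_cases i <;> simp only [lcross, cons_val, Pi.zero_apply, Fin.zero_eta, Fin.mk_one,
    Fin.reduceFinMk]
  · linear_combination v 0 * ha - a 0 * hv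
  · linear_combination v 1 * ha - a 1 * hv
  · linear_combination v 2 * ha - a 2 * hv

lemma mdot_mulVec_lcross (g : Matrix (Fin 3) (Fin 3) ℝ) (x y z : V3) :
    mdot (g.mulVec x) (lcross (g.mulVec y) (g.mulVec z)) = g.det * mdot x (lcross y z) := by
  simp only [mdot, lcross, cons_val, det_fin_three, mulVec, dotProduct, Fin.sum_univ_three]
  ring

lemma mulVec_lcross {g : Matrix (Fin 3) (Fin 3) ℝ} (hg : isLorentz g) (hdet : g.det = 1)
    (x y : V3) : g.mulVec (lcross x y) = lcross (g.mulVec x) (g.mulVec y) := by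
  by_contra hne
  obtain ⟨z, hz⟩ := exists_mdot_ne_zero (sub_ne_zero.mpr hne)
  have hu : IsUnit g := (isUnit_iff_isUnit_det g).mpr (hdet ▸ isUnit_one)
  obtain ⟨w, rfl⟩ := mulVec_surjective_iff_isUnit.mpr hu z
  apply hz
  rw [mdot_comm, mdot_sub_left, hg, mdot_comm (lcross _ _) (g.mulVec w), mdot_mulVec_lcross, hdet,
    one_mul, mdot_comm, sub_self]

lemma mdot_mulVec_sub_eq_zero {g : Matrix (Fin 3) (Fin 3) ℝ} (hg : isLorentz g) {v : V3}
    (hv : g.mulVec v = v) (x : V3) : mdot (g.mulVec x - x) v = 0 := by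
  have h := hg x v
  rw [hv] at h
  rw [mdot_sub_left, h, sub_self]

/-- The fixed vectors of a nontrivial element of `SO(2,1)` span at most a line. -/
lemma exists_smul_eq_of_mulVec_eq {g : Matrix (Fin 3) (Fin 3) ℝ} (hg : isLorentz g)
    (hdet : g.det = 1) (hne : g ≠ 1) {v a : V3} (hv0 : v ≠ 0) (hv : g.mulVec v = v)
    (ha : g.mulVec a = a) : ∃ t : ℝ, t • v = a := by
  apply exists_smul_eq_of_lcross_eq_zero hv0
  by_contra hc
  apply hne
  have hgc := mulVec_lcross hg hdet v a
  rw [hv, ha] at hgc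
  have key (x : V3) : ∃ t : ℝ, t • lcross v a = g.mulVec x - x :=
    exists_smul_eq_of_lcross_eq_zero hc (lcross_lcross_eq_zero
      (mdot_mulVec_sub_eq_zero hg hv x) (mdot_mulVec_sub_eq_zero hg ha x))
  have hfix_of_ne (x : V3) (hx : mdot x (lcross v a) ≠ 0) : g.mulVec x = x := by
    obtain ⟨t, ht⟩ := key x
    have h1 := mdot_mulVec_sub_eq_zero hg hgc x
    rw [← ht, mdot_smul_left] at h1
    have h2 := hg x x
    rw [← sub_add_cancel (g.mulVec x) x, ← ht, mdot_add_left, mdot_smul_left,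
      mdot_comm _ (_ + x), mdot_comm x (_ + x), mdot_add_left, mdot_add_left, mdot_smul_left,
      mdot_smul_left, mdot_comm (lcross v a) x] at h2
    have h3 : t * mdot x (lcross v a) = 0 := by linear_combination h2 / 2 - t / 2 * h1
    rw [(mul_eq_zero.mp h3).resolve_right hx, zero_smul] at ht
    exact sub_eq_zero.mp ht.symm
  obtain ⟨y, hy⟩ := exists_mdot_ne_zero hc
  refine ext_of_mulVec_single fun i => ?_
  rw [one_mulVec]
  generalize (Pi.single i 1 : V3) = x
  by_cases hx : mdot x (lcross v a) = 0
  · have h := hfix_of_ne (x + y) (by rwa [mdot_add_left, hx, zero_add])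
    rw [mulVec_add, hfix_of_ne y hy] at h
    exact add_right_cancel h
  · exact hfix_of_ne x hx

lemma isHyperbolic.ne_one {g : Matrix (Fin 3) (Fin 3) ℝ} (hg : isHyperbolic g) : g ≠ 1 := by
  rintro rfl
  obtain ⟨a, b, c, hab, -, -, h⟩ := hg
  rw [charpoly_one] at h
  have ha := congrArg (Polynomial.eval a) h
  have hb := congrArg (Polynomial.eval b) h
  simp [sub_eq_zero] at ha hb
  exact hab (ha.trans hb.symm)

/-- The linear functional `x ↦ x·v`. -/
def mdotRight (v : V3) : V3 →ₗ[ℝ] ℝ where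
  toFun x := mdot x v
  map_add' x y := mdot_add_left x y v
  map_smul' t x := mdot_smul_left t x v

/-- The image of `g - 1` is the orthogonal complement of a fixed vector of `g`. -/
lemma range_mulVecLin_sub_one {g : Matrix (Fin 3) (Fin 3) ℝ} (hg : isLorentz g)
    (hdet : g.det = 1) (hne : g ≠ 1) {v : V3} (hv0 : v ≠ 0) (hv : g.mulVec v = v) :
    LinearMap.range (g - 1).mulVecLin = LinearMap.ker (mdotRight v) := by
  have hmem {x : V3} : x ∈ LinearMap.ker (g - 1).mulVecLin ↔ g.mulVec x = x := by
    rw [LinearMap.mem_ker, mulVecLin_apply, sub_mulVec, one_mulVec, sub_eq_zero]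
  have hker : Module.finrank ℝ (LinearMap.ker (g - 1).mulVecLin) = 1 := by
    refine (finrank_eq_one_iff_of_nonzero' ⟨v, hmem.mpr hv⟩ (by simpa using hv0)).mpr ?_
    rintro ⟨a, ha⟩
    obtain ⟨t, ht⟩ := exists_smul_eq_of_mulVec_eq hg hdet hne hv0 hv (hmem.mp ha)
    exact ⟨t, Subtype.ext ht⟩
  have hperp : mdotRight v ≠ 0 := by
    obtain ⟨y, hy⟩ := exists_mdot_ne_zero hv0
    exact fun h => hy (LinearMap.congr_fun h y)
  have h1 := LinearMap.finrank_range_add_finrank_ker (g - 1).mulVecLin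
  have h2 := Module.Dual.finrank_ker_add_one_of_ne_zero hperp
  rw [hker, Module.finrank_fin_fun] at h1
  rw [Module.finrank_fin_fun] at h2
  refine Submodule.eq_of_le_of_finrank_eq ?_ (Nat.add_right_cancel (h1.trans h2.symm))
  rintro _ ⟨x, rfl⟩
  rw [LinearMap.mem_ker, mulVecLin_apply, sub_mulVec, one_mulVec]
  exact mdot_mulVec_sub_eq_zero hg hv x

/-- For an affine isometry `γ(x) = gx + u` with `g ∈ SO(2,1)⁰`
hyperbolic or parabolic, and `v ≠ 0` with `gv = v`, the Margulis invariant
`α_v(γ) = u·v` vanishes if and only if `γ` fixes a point. -/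
theorem margulis_invariant_zero_iff_fixed_point
    (g : Matrix (Fin 3) (Fin 3) ℝ) (u v : V3)
    (hg : inSO21p g) (hgt : isHyperbolic g ∨ isParabolic g)
    (hv : v ≠ 0) (hfix : g.mulVec v = v) :
    mdot u v = 0 ↔ ∃ x : V3, g.mulVec x + u = x := by
  obtain ⟨hL, hdet, -⟩ := hg
  have hne : g ≠ 1 := hgt.elim isHyperbolic.ne_one And.left
  have hmem : mdot u v = 0 ↔ u ∈ LinearMap.range (g - 1).mulVecLin := by
    rw [range_mulVecLin_sub_one hL hdet hne hv hfix]
    rfl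
  simp only [hmem, LinearMap.mem_range, mulVecLin_apply, sub_mulVec, one_mulVec]
  constructor
  · rintro ⟨x, rfl⟩
    exact ⟨-x, by rw [mulVec_neg]; abel⟩
  · rintro ⟨x, hx⟩
    refine ⟨-x, ?_⟩
    rw [mulVec_neg, sub_neg_eq_add, neg_add_eq_sub, sub_eq_iff_eq_add', hx]
end
end

section
/- Let p, q ∈ ℝ³, let v be a unit spacelike vector, and let w be a future-pointing timelike vector with w·v ≠ 0. Then there exists T ∈ ℝ such that q + tw lies in the interior H(v,p) ∖ C(v,p) of the crooked half-space H(v,p) for all t ≥ T, if and only if w·v > 0. -/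
open Matrix

noncomputable section

/-- Future-pointing timelike and future-pointing null vectors have negative product. -/
theorem mdot_neg_of_timelike_of_null {w n : V3} (hw : mdot w w < 0) (hwfut : 0 < w 2)
    (hn : mdot n n = 0) (hnfut : 0 < n 2) : mdot w n < 0 := by
  unfold mdot at *
  have hn2 : 0 < n 2 ^ 2 := by positivity
  have hlt : (w 0 * n 0 + w 1 * n 1) ^ 2 < (w 2 * n 2) ^ 2 := by
    calc (w 0 * n 0 + w 1 * n 1) ^ 2
        ≤ (w 0 ^ 2 + w 1 ^ 2) * (n 0 ^ 2 + n 1 ^ 2) := by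
          nlinarith [sq_nonneg (w 0 * n 1 - w 1 * n 0)]
      _ = (w 0 ^ 2 + w 1 ^ 2) * n 2 ^ 2 := by
          rw [show n 0 ^ 2 + n 1 ^ 2 = n 2 ^ 2 by linarith]
      _ < w 2 ^ 2 * n 2 ^ 2 := mul_lt_mul_of_pos_right (by linarith) hn2
      _ = (w 2 * n 2) ^ 2 := by ring
  linarith [lt_of_pow_lt_pow_left₀ 2 (mul_pos hwfut hnfut).le hlt]

theorem sq_add_sq_pos_of_unit {v : V3} (hv : mdot v v = 1) : 0 < v 0 ^ 2 + v 1 ^ 2 := by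
  unfold mdot at hv
  nlinarith [sq_nonneg (v 2)]

theorem nullPlus_pos {v : V3} (hv : mdot v v = 1) : 0 < nullPlus v 2 := by
  have := sq_add_sq_pos_of_unit hv
  simp only [nullPlus, Pi.smul_apply, smul_eq_mul, cons_val]
  positivity

theorem nullMinus_pos {v : V3} (hv : mdot v v = 1) : 0 < nullMinus v 2 := by
  have := sq_add_sq_pos_of_unit hv
  simp only [nullMinus, Pi.smul_apply, smul_eq_mul, cons_val]
  positivity

theorem mdot_nullPlus_self {v : V3} (hv : mdot v v = 1) :
    mdot (nullPlus v) (nullPlus v) = 0 := by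
  unfold nullPlus
  rw [hv, Real.sqrt_one]
  generalize 1 / (√2 * (v 0 ^ 2 + v 1 ^ 2)) = c
  simp only [mdot, Pi.smul_apply, smul_eq_mul, cons_val] at hv ⊢
  linear_combination (-c ^ 2 * (v 0 ^ 2 + v 1 ^ 2)) * hv

theorem mdot_nullMinus_self {v : V3} (hv : mdot v v = 1) :
    mdot (nullMinus v) (nullMinus v) = 0 := by
  unfold nullMinus
  rw [hv, Real.sqrt_one]
  generalize 1 / (√2 * (v 0 ^ 2 + v 1 ^ 2)) = c
  simp only [mdot, Pi.smul_apply, smul_eq_mul, cons_val] at hv ⊢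
  linear_combination (-c ^ 2 * (v 0 ^ 2 + v 1 ^ 2)) * hv

theorem mdot_ray_sub (p q w n : V3) (t : ℝ) :
    mdot (q + t • w - p) n = mdot (q - p) n + t * mdot w n := by
  simp only [mdot, Pi.add_apply, Pi.sub_apply, Pi.smul_apply, smul_eq_mul]
  ring

theorem eventually_mdot_ray_neg (p q : V3) {w n : V3} (h : mdot w n < 0) :
    ∀ᶠ t : ℝ in Filter.atTop, mdot (q + t • w - p) n < 0 := by
  simp only [mdot_ray_sub]
  exact (Filter.tendsto_atBot_add_const_left _ _
    (Filter.tendsto_id.atTop_mul_const_of_neg h)).eventually_lt_atBot 0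

theorem eventually_mdot_ray_pos (p q : V3) {w n : V3} (h : 0 < mdot w n) :
    ∀ᶠ t : ℝ in Filter.atTop, 0 < mdot (q + t • w - p) n := by
  simp only [mdot_ray_sub]
  exact (Filter.tendsto_atTop_add_const_left _ _
    (Filter.tendsto_id.atTop_mul_const h)).eventually_gt_atTop 0

/-- Let `v` be unit spacelike and `w` a future-pointing timelike
vector with `w·v ≠ 0`.  Then `q + tw` lies in the interior `H(v,p) ∖ C(v,p)` of
the crooked half-space for all sufficiently large `t` if and only if `w·v > 0`. -/
theorem timelike_ray_eventually_in_halfspace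
    (p q v w : V3)
    (hv : mdot v v = 1)
    (hw : mdot w w < 0) (hwfut : 0 < w 2)
    (hwv : mdot w v ≠ 0) :
    (∃ T : ℝ, ∀ t : ℝ, T ≤ t → q + t • w ∈ crookedHalf v p \ crookedPlane v p) ↔
      0 < mdot w v := by
  have hplus := eventually_mdot_ray_neg p q
    (mdot_neg_of_timelike_of_null hw hwfut (mdot_nullPlus_self hv) (nullPlus_pos hv))
  have hminus := eventually_mdot_ray_neg p q
    (mdot_neg_of_timelike_of_null hw hwfut (mdot_nullMinus_self hv) (nullMinus_pos hv))
  rw [← Filter.eventually_atTop]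
  constructor
  · intro h
    by_contra hle
    obtain ⟨t, ⟨⟨-, hH⟩, -⟩, hm, hneg⟩ := (h.and (hminus.and
      (eventually_mdot_ray_neg p q (lt_of_le_of_ne (not_lt.mp hle) hwv)))).exists
    exact hm.not_ge (hH hneg.le)
  · intro hpos
    filter_upwards [hplus, hminus, eventually_mdot_ray_pos p q hpos] with t hp hm h
    refine ⟨⟨fun _ => hp.le, fun h' => absurd h' h.not_ge⟩, ?_⟩
    rintro ((hs | hs) | hs)
    · exact h.ne' hs.1
    · exact hp.ne hs.2.1
    · exact hm.ne hs.2.1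
end
end
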